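/- For every positive integer n and every set α ⊆ ⋃_{j=1}^n S_j with 1 ≤ card(α) ≤ n, the distortion error satisfies ∫ min_{a∈α} ‖y − a‖² dP(y) ≥ (4n² + 12n + 13)/(24n²). -/

import Mathlib

open MeasureTheory

noncomputable section

/-- The Euclidean plane ℝ². -/
abbrev Plane : Type := EuclideanSpace ℝ (Fin 2)

/-- The point (x, y) in the Euclidean plane. -/
def pt (x y : ℝ) : Plane := (WithLp.equiv 2 (Fin 2 → ℝ)).symm ![x, y]

/-- P: the uniform probability measure on the segment J = [0,1] × {0}, i.e. the pushforward
of Lebesgue measure restricted to [0,1] under x ↦ (x, 0). -/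
def P : Measure Plane :=
  Measure.map (fun x : ℝ => pt x 0) (volume.restrict (Set.Icc (0 : ℝ) 1))

/-- The constraint S_j = {(x, x + 1/j) : -1/j ≤ x ≤ 1}. -/
def S (j : ℕ) : Set Plane :=
  {p | ∃ x : ℝ, -(1 / (j : ℝ)) ≤ x ∧ x ≤ 1 ∧ p = pt x (x + 1 / (j : ℝ))}

/-- min_{b ∈ β} ‖y - b‖², written as an infimum over the image set. -/
def minDist (β : Set Plane) (y : Plane) : ℝ :=
  sInf ((fun b => ‖y - b‖ ^ 2) '' β)

/-- The distortion error ∫ min_{b ∈ β} ‖y - b‖² dP(y) of a set β. -/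
def distortion (β : Set Plane) : ℝ := ∫ y, minDist β y ∂P

/-- The n-th constrained quantization error for P with respect to the family (S_j). -/
def Vn (n : ℕ) : ℝ :=
  sInf {v : ℝ | ∃ α : Finset Plane,
    ↑α ⊆ (⋃ j ∈ Finset.Icc 1 n, S j) ∧ 1 ≤ α.card ∧ α.card ≤ n ∧ v = distortion ↑α}

lemma minDist_coe_eq_inf' (α : Finset Plane) (hα : α.Nonempty) (y : Plane) :
    minDist ↑α y = α.inf' hα (fun b => ‖y - b‖ ^ 2) := by
  rw [minDist, Finset.inf'_eq_csInf_image]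

lemma continuous_minDist (α : Finset Plane) (hα : α.Nonempty) :
    Continuous (minDist ↑α) := by
  rw [funext (minDist_coe_eq_inf' α hα)]
  exact Continuous.finset_inf'_apply hα (fun b _ => by fun_prop)

lemma continuous_pt_zero : Continuous (fun x : ℝ => pt x 0) := by
  have h : (fun x : ℝ => pt x 0) = fun x : ℝ => WithLp.toLp 2 ![x, 0] := rfl
  rw [h]
  refine (PiLp.continuous_toLp 2 _).comp (continuous_pi fun i => ?_)
  fin_cases i
  · exact continuous_id
  · exact continuous_const

lemma distortion_eq_setIntegral (α : Finset Plane) (hα : α.Nonempty) :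
    distortion ↑α = ∫ t in Set.Icc (0 : ℝ) 1, minDist ↑α (pt t 0) :=
  integral_map continuous_pt_zero.measurable.aemeasurable
    (continuous_minDist α hα).aestronglyMeasurable

/-- The squared distance from `(t, 0)` to `p`, split along the two diagonal directions. -/
lemma norm_pt_zero_sub_sq (t : ℝ) (p : Plane) :
    ‖pt t 0 - p‖ ^ 2 = (t + (p 1 - p 0)) ^ 2 / 2 + (t - (p 0 + p 1)) ^ 2 / 2 := by
  simp only [EuclideanSpace.norm_sq_eq, Fin.sum_univ_two, PiLp.sub_apply, pt, Real.norm_eq_abs,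
    sq_abs, WithLp.equiv_symm_apply, Matrix.cons_val_zero, Matrix.cons_val_one]
  ring

lemma one_div_le_of_mem_iUnion_S {n : ℕ} {p : Plane} (hp : p ∈ ⋃ j ∈ Finset.Icc 1 n, S j) :
    1 / (n : ℝ) ≤ p 1 - p 0 := by
  simp only [Set.mem_iUnion, Finset.mem_Icc, exists_prop] at hp
  obtain ⟨j, ⟨hj1, hjn⟩, x, -, -, rfl⟩ := hp
  have hj : (1 : ℝ) / n ≤ 1 / j :=
    one_div_le_one_div_of_le (by exact_mod_cast hj1) (by exact_mod_cast hjn)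
  simpa [pt] using hj

/-- A truncated parabola of height `r ^ 2` has total mass at most `4 * r ^ 3 / 3` on any set. -/
lemma setIntegral_max_sq_sub_sq_le (s : Set ℝ) {r : ℝ} (hr : 0 ≤ r) (u : ℝ) :
    ∫ t in s, max (r ^ 2 - (t - u) ^ 2) 0 ≤ 4 * r ^ 3 / 3 := by
  have hind : (fun t : ℝ => max (r ^ 2 - (t - u) ^ 2) 0) =
      (Set.Icc (u - r) (u + r)).indicator fun t => r ^ 2 - (t - u) ^ 2 := by
    funext t
    by_cases ht : t ∈ Set.Icc (u - r) (u + r)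
    · rw [Set.indicator_of_mem ht]
      refine max_eq_left ?_
      nlinarith [ht.1, ht.2]
    · rw [Set.indicator_of_notMem ht]
      refine max_eq_right ?_
      rw [Set.mem_Icc, not_and_or, not_le, not_le] at ht
      rcases ht with h | h <;> nlinarith
  have hcont : Continuous fun t : ℝ => r ^ 2 - (t - u) ^ 2 := by fun_prop
  have hint : Integrable (fun t : ℝ => max (r ^ 2 - (t - u) ^ 2) 0) := by
    rw [hind, integrable_indicator_iff measurableSet_Icc]
    exact hcont.integrableOn_Icc
  refine (setIntegral_le_integral hint (.of_forall fun t => le_max_right _ _)).trans ?_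
  rw [hind, integral_indicator measurableSet_Icc, integral_Icc_eq_integral_Ioc,
    ← intervalIntegral.integral_of_le (by linarith),
    intervalIntegral.integral_comp_sub_right (fun t => r ^ 2 - t ^ 2) u,
    intervalIntegral.integral_sub (by simp) (by simp)]
  simp only [intervalIntegral.integral_const, integral_pow, smul_eq_mul]
  apply le_of_eq
  push_cast
  ring

/-- every admissible set α ⊆ ⋃_{j=1}^n S_j with 1 ≤ card(α) ≤ n has distortion
error at least (4n² + 12n + 13)/(24n²). -/
theorem distortion_lower_bound (n : ℕ) (hn : 1 ≤ n) (α : Finset Plane)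
    (hsub : ↑α ⊆ (⋃ j ∈ Finset.Icc 1 n, S j)) (hcard₁ : 1 ≤ α.card) (hcard₂ : α.card ≤ n) :
    (4 * (n : ℝ) ^ 2 + 12 * n + 13) / (24 * (n : ℝ) ^ 2) ≤ distortion ↑α := by
  have hα : α.Nonempty := Finset.card_pos.mp hcard₁
  have hn0 : (0 : ℝ) < n := by exact_mod_cast hn
  set r : ℝ := 1 / (2 * n) with hr
  have hr0 : 0 < r := by positivity
  rw [distortion_eq_setIntegral α hα]
  have hbound : ∀ t ∈ Set.Icc (0 : ℝ) 1,
      ((t + 1 / n) ^ 2 + r ^ 2) / 2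
        - (∑ a ∈ α, max (r ^ 2 - (t - (a 0 + a 1)) ^ 2) 0) / 2 ≤ minDist ↑α (pt t 0) := by
    intro t ht
    rw [minDist_coe_eq_inf' α hα]
    refine Finset.le_inf' hα _ fun b hb => ?_
    rw [norm_pt_zero_sub_sq]
    have hsum := Finset.single_le_sum
      (f := fun a : Plane => max (r ^ 2 - (t - (a 0 + a 1)) ^ 2) 0)
      (fun a _ => le_max_right _ _) hb
    have hmax := le_max_left (r ^ 2 - (t - (b 0 + b 1)) ^ 2) 0
    have hc := one_div_le_of_mem_iUnion_S (hsub hb)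
    have hsq : (t + 1 / (n : ℝ)) ^ 2 ≤ (t + (b 1 - b 0)) ^ 2 :=
      pow_le_pow_left₀ (add_nonneg ht.1 (by positivity)) (by linarith) 2
    dsimp only at hsum
    linarith
  have hI₁ : IntegrableOn (fun t : ℝ => ((t + 1 / n) ^ 2 + r ^ 2) / 2) (Set.Icc 0 1) :=
    (by fun_prop : Continuous fun t : ℝ => ((t + 1 / n) ^ 2 + r ^ 2) / 2).integrableOn_Icc
  have hI : ∀ a ∈ α, IntegrableOn (fun t : ℝ => max (r ^ 2 - (t - (a 0 + a 1)) ^ 2) 0)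
      (Set.Icc 0 1) := fun a _ =>
    (by fun_prop : Continuous fun t : ℝ =>
      max (r ^ 2 - (t - (a 0 + a 1)) ^ 2) 0).integrableOn_Icc
  have hI₂ : IntegrableOn (fun t : ℝ =>
      (∑ a ∈ α, max (r ^ 2 - (t - (a 0 + a 1)) ^ 2) 0) / 2) (Set.Icc 0 1) :=
    (integrable_finsetSum α hI).div_const 2
  have hI₃ : IntegrableOn (fun t : ℝ => minDist ↑α (pt t 0)) (Set.Icc 0 1) :=
    ((continuous_minDist α hα).comp continuous_pt_zero).integrableOn_Icc
  refine le_trans ?_ (setIntegral_mono_on (hI₁.sub hI₂) hI₃ measurableSet_Icc hbound)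
  have hsum : ∑ a ∈ α, ∫ t in Set.Icc (0 : ℝ) 1, max (r ^ 2 - (t - (a 0 + a 1)) ^ 2) 0
      ≤ n * (4 * r ^ 3 / 3) := by
    refine (Finset.sum_le_card_nsmul α _ _ fun a _ =>
      setIntegral_max_sq_sub_sq_le _ hr0.le _).trans ?_
    rw [nsmul_eq_mul]
    gcongr
  have hmain : ∫ t in Set.Icc (0 : ℝ) 1, ((t + 1 / n) ^ 2 + r ^ 2) / 2
      = (((1 + 1 / (n : ℝ)) ^ 3 - (1 / (n : ℝ)) ^ 3) / 3 + r ^ 2) / 2 := by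
    rw [integral_Icc_eq_integral_Ioc, ← intervalIntegral.integral_of_le zero_le_one,
      intervalIntegral.integral_div,
      intervalIntegral.integral_comp_add_right (fun t => t ^ 2 + r ^ 2) (1 / (n : ℝ)),
      intervalIntegral.integral_add (by simp) (by simp)]
    simp only [intervalIntegral.integral_const, integral_pow, smul_eq_mul]
    push_cast
    ring
  rw [integral_sub' hI₁ hI₂, hmain, integral_div, integral_finsetSum α hI]
  have hval : (4 * (n : ℝ) ^ 2 + 12 * n + 13) / (24 * (n : ℝ) ^ 2)
      = (((1 + 1 / (n : ℝ)) ^ 3 - (1 / (n : ℝ)) ^ 3) / 3 + r ^ 2) / 2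
        - n * (4 * r ^ 3 / 3) / 2 := by
    rw [hr]
    field_simp
    ring
  linarith

end
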